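/- arXiv:2312.10554 — 2 statements merged into one kernel-verified Lean document; each statement's English description precedes it below -/
import Mathlib

section
/- Let A, B, C, D ∈ E = EuclideanSpace ℝ (Fin 3) be the vertices of an isosceles tetrahedron (affinely independent, with dist A B = dist C D, dist A C = dist B D, dist A D = dist B C), and let K = convexHull ℝ {A, B, C, D}. Then for every real number L there exists a simple closed geodesic in frontier K whose length exceeds L. -/
/-- A simple closed geodesic in a closed set `F ⊆ EuclideanSpace ℝ (Fin 3)`:
a continuous map `γ : ℝ → E`, periodic with period 1, injective on `[0,1)`,
with image in `F`, of finite positive length (total variation on `[0,1]`),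
that is locally shortest among continuous paths in `F`. -/
def IsSimpleClosedGeodesicIn (F : Set (EuclideanSpace ℝ (Fin 3)))
    (γ : ℝ → EuclideanSpace ℝ (Fin 3)) : Prop :=
  Continuous γ ∧
  Function.Periodic γ 1 ∧
  Set.InjOn γ (Set.Ico (0 : ℝ) 1) ∧
  (∀ t : ℝ, γ t ∈ F) ∧
  0 < eVariationOn γ (Set.Icc 0 1) ∧
  eVariationOn γ (Set.Icc 0 1) < ⊤ ∧
  ∀ t : ℝ, ∃ ε > (0 : ℝ), ∀ s₁ s₂ : ℝ,
    s₁ ∈ Set.Ioo (t - ε) (t + ε) → s₂ ∈ Set.Ioo (t - ε) (t + ε) → s₁ ≤ s₂ →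
    ∀ (a b : ℝ) (c : ℝ → EuclideanSpace ℝ (Fin 3)), a ≤ b →
      ContinuousOn c (Set.Icc a b) → c a = γ s₁ → c b = γ s₂ →
      (∀ x ∈ Set.Icc a b, c x ∈ F) →
      eVariationOn γ (Set.Icc s₁ s₂) ≤ eVariationOn c (Set.Icc a b)


namespace Disphenoid

/-! ### The triangle wave -/

/-- The triangle wave of period `2` with value `(-1) ^ n` at each integer `n`, linear in between. -/
noncomputable def triWave (x : ℝ) : ℝ := 1 - 2 * |x - 2 * round (x / 2)|

theorem abs_sub_two_mul_round_le (x : ℝ) (k : ℤ) :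
    |x - 2 * round (x / 2)| ≤ |x - 2 * k| := by
  have h := round_le (x / 2) k
  have e : ∀ z : ℝ, |x - 2 * z| = 2 * |x / 2 - z| := fun z => by
    rw [← abs_two, ← abs_mul, abs_two]; congr 1; ring
  rw [e, e]; linarith

theorem abs_triWave_sub_le (x y : ℝ) : |triWave x - triWave y| ≤ 2 * |x - y| := by
  have key : ∀ x y : ℝ, triWave x - triWave y ≤ 2 * |x - y| := fun x y => by
    have h := abs_sub_two_mul_round_le y (round (x / 2))
    have h' := abs_sub_le y x (2 * round (x / 2))
    rw [abs_sub_comm y x] at h'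
    unfold triWave; linarith
  exact abs_sub_le_iff.2 ⟨key x y, abs_sub_comm x y ▸ key y x⟩

theorem triWave_add_two_mul (x : ℝ) (k : ℤ) : triWave (x + 2 * k) = triWave x := by
  unfold triWave
  rw [show (x + 2 * k) / 2 = x / 2 + k by ring, round_add_intCast]
  push_cast; ring_nf

theorem eq_or_eq_neg_of_triWave_eq {x y : ℝ} (h : triWave x = triWave y) :
    ∃ k : ℤ, x - y = 2 * k ∨ x + y = 2 * k := by
  have h' : |x - 2 * round (x / 2)| = |y - 2 * round (y / 2)| := by
    unfold triWave at h; linarith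
  rcases abs_eq_abs.1 h' with h' | h'
  · exact ⟨round (x / 2) - round (y / 2), Or.inl (by push_cast; linarith)⟩
  · exact ⟨round (x / 2) + round (y / 2), Or.inr (by push_cast; linarith)⟩

theorem triWave_of_abs_le {x : ℝ} (k : ℤ) (h : |x - 2 * k| ≤ 1) :
    triWave x = 1 - 2 * |x - 2 * k| := by
  have h₁ := abs_sub_two_mul_round_le x k
  suffices |x - 2 * k| ≤ |x - 2 * round (x / 2)| by unfold triWave; linarith
  rcases eq_or_ne (round (x / 2)) k with e | e
  · rw [e]
  · have h₂ : (1 : ℝ) ≤ |(round (x / 2) : ℝ) - k| := by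
      exact_mod_cast Int.one_le_abs (sub_ne_zero.2 e)
    have h₃ := abs_sub_le (2 * (round (x / 2) : ℝ)) x (2 * k)
    rw [← mul_sub, abs_mul, abs_two, abs_sub_comm _ x] at h₃
    linarith

theorem triWave_of_abs_le_odd {x : ℝ} (k : ℤ) (h : |x - (2 * k + 1)| ≤ 1) :
    triWave x = -(1 - 2 * |x - (2 * k + 1)|) := by
  rcases le_total 0 (x - (2 * k + 1)) with h0 | h0
  · rw [abs_of_nonneg h0] at h ⊢
    have e : |x - 2 * ((k + 1 : ℤ) : ℝ)| = -(x - 2 * ((k + 1 : ℤ) : ℝ)) :=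
      abs_of_nonpos (by push_cast; linarith)
    rw [triWave_of_abs_le (k + 1) (by rw [e]; push_cast; linarith), e]; push_cast; ring
  · rw [abs_of_nonpos h0] at h ⊢
    have e : |x - 2 * (k : ℝ)| = x - 2 * (k : ℝ) := abs_of_nonneg (by linarith)
    rw [triWave_of_abs_le k (by rw [e]; linarith), e]; ring

/-- Near an integer `n` the triangle wave has an extremum with value `±1`. -/
theorem exists_triWave_eq_kink (n : ℤ) :
    ∃ ε : ℝ, ε ^ 2 = 1 ∧ ∀ x : ℝ, |x - n| ≤ 1 → triWave x = ε * (1 - 2 * |x - n|) := by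
  rcases Int.even_or_odd' n with ⟨k, rfl | rfl⟩
  · refine ⟨1, by norm_num, fun x hx => ?_⟩
    push_cast at hx ⊢
    rw [triWave_of_abs_le k hx, one_mul]
  · refine ⟨-1, by norm_num, fun x hx => ?_⟩
    push_cast at hx ⊢
    rw [triWave_of_abs_le_odd k hx]; ring

theorem exists_floor_lt {x₀ : ℝ} (h : ∀ n : ℤ, x₀ ≠ n) : ∃ n : ℤ, n < x₀ ∧ x₀ < n + 1 :=
  ⟨⌊x₀⌋, lt_of_le_of_ne (Int.floor_le x₀) (h _).symm, Int.lt_floor_add_one x₀⟩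

/-- Away from the integers the triangle wave is locally affine with slope `±2`. -/
theorem exists_triWave_eq_affine {x₀ : ℝ} (h : ∀ n : ℤ, x₀ ≠ n) :
    ∃ m : ℝ, m ^ 2 = 4 ∧ ∃ δ > 0, ∀ x, |x - x₀| < δ →
      triWave x = triWave x₀ + m * (x - x₀) := by
  obtain ⟨n, h₁, h₂⟩ := exists_floor_lt h
  obtain ⟨ε, hε, H⟩ := exists_triWave_eq_kink n
  refine ⟨-2 * ε, by linear_combination 4 * hε, min (x₀ - n) (n + 1 - x₀),
    lt_min (by linarith) (by linarith), fun x hx => ?_⟩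
  have hx₁ := abs_lt.1 (hx.trans_le (min_le_left _ _))
  have hx₂ := abs_lt.1 (hx.trans_le (min_le_right _ _))
  have e₁ : |x - n| = x - n := abs_of_nonneg (by linarith)
  have e₂ : |x₀ - n| = x₀ - n := abs_of_nonneg (by linarith)
  rw [H x (by rw [e₁]; linarith), H x₀ (by rw [e₂]; linarith), e₁, e₂]; ring

theorem abs_triWave_lt_one {x₀ : ℝ} (h : ∀ n : ℤ, x₀ ≠ n) : |triWave x₀| < 1 := by
  obtain ⟨n, h₁, h₂⟩ := exists_floor_lt h
  obtain ⟨ε, hε, H⟩ := exists_triWave_eq_kink n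
  have e₂ : |x₀ - n| = x₀ - n := abs_of_nonneg (by linarith)
  rw [H x₀ (by rw [e₂]; linarith), e₂]
  have hε' : |ε| = 1 := by rw [← sq_abs] at hε; nlinarith [abs_nonneg ε]
  rw [abs_mul, hε', one_mul, abs_lt]
  constructor <;> linarith

/-- Composite of the triangle wave with an affine function, near a parameter where the
affine function is not an integer. -/
theorem exists_triWave_comp_eq_affine {a b t : ℝ} (h : ∀ n : ℤ, a * t + b ≠ n) :
    ∃ m : ℝ, m ^ 2 = (2 * a) ^ 2 ∧ ∃ δ > 0, ∀ s, |s - t| < δ →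
      triWave (a * s + b) = triWave (a * t + b) + m * (s - t) := by
  obtain ⟨m, hm, δ, hδ, H⟩ := exists_triWave_eq_affine h
  refine ⟨m * a, by rw [mul_pow, hm]; ring, δ / (|a| + 1), by positivity, fun s hs => ?_⟩
  rw [lt_div_iff₀ (by positivity)] at hs
  rw [H (a * s + b)]
  · ring
  · rw [show a * s + b - (a * t + b) = (s - t) * a by ring, abs_mul]
    nlinarith [abs_nonneg (s - t)]

/-- Composite of the triangle wave with an affine function, near a parameter where the
affine function is an integer. -/
theorem exists_triWave_comp_eq_kink {a b t : ℝ} {n : ℤ} (h : a * t + b = n) :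
    ∃ ε : ℝ, ε ^ 2 = 1 ∧ ∃ δ > 0, ∀ s, |s - t| < δ →
      triWave (a * s + b) = ε * (1 - 2 * |a| * |s - t|) := by
  obtain ⟨ε, hε, H⟩ := exists_triWave_eq_kink n
  refine ⟨ε, hε, 1 / (|a| + 1), by positivity, fun s hs => ?_⟩
  rw [lt_div_iff₀ (by positivity)] at hs
  have e : |a * s + b - n| = |a| * |s - t| := by rw [← h, ← abs_mul]; congr 1; ring
  rw [H (a * s + b), e]
  · ring
  · rw [e]; nlinarith [abs_nonneg (s - t)]

/-! ### The surface in normalised coordinates -/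

/-- The boundary of the tetrahedron with vertices `(1, 1, 1)`, `(1, -1, -1)`, `(-1, 1, -1)`,
`(-1, -1, 1)`. -/
def OnSurface (X Y Z : ℝ) : Prop :=
  0 ≤ 1 + X + Y + Z ∧ 0 ≤ 1 + X - Y - Z ∧ 0 ≤ 1 - X + Y - Z ∧ 0 ≤ 1 - X - Y + Z ∧
    (1 + X + Y + Z) * (1 + X - Y - Z) * (1 - X + Y - Z) * (1 - X - Y + Z) = 0

theorem OnSurface.swap₁₂ {X Y Z : ℝ} (h : OnSurface X Y Z) : OnSurface Y X Z := by
  obtain ⟨h₁, h₂, h₃, h₄, h₅⟩ := h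
  exact ⟨by linarith, by linarith, by linarith, by linarith, by linear_combination h₅⟩

theorem OnSurface.swap₂₃ {X Y Z : ℝ} (h : OnSurface X Y Z) : OnSurface X Z Y := by
  obtain ⟨h₁, h₂, h₃, h₄, h₅⟩ := h
  exact ⟨by linarith, by linarith, by linarith, by linarith, by linear_combination h₅⟩

theorem exists_eq_add_two_mul (x : ℝ) : ∃ (k : ℤ) (y : ℝ), x = y + 2 * k ∧ 0 ≤ y ∧ y ≤ 2 := by
  refine ⟨⌊x / 2⌋, x - 2 * ⌊x / 2⌋, by ring, ?_, ?_⟩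
  · linarith [Int.floor_le (x / 2)]
  · linarith [Int.lt_floor_add_one (x / 2)]

/-- The folding map `(x, y) ↦ (triWave y, triWave x, triWave (x + y))` lands in the surface. -/
theorem onSurface_triWave (x y : ℝ) :
    OnSurface (triWave y) (triWave x) (triWave (x + y)) := by
  obtain ⟨k, x, rfl, hx₀, hx₂⟩ := exists_eq_add_two_mul x
  obtain ⟨l, y, rfl, hy₀, hy₂⟩ := exists_eq_add_two_mul y
  rw [show x + 2 * (k : ℝ) + (y + 2 * l) = x + y + 2 * ((k + l : ℤ) : ℝ) by push_cast; ring,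
    triWave_add_two_mul, triWave_add_two_mul, triWave_add_two_mul]
  have T₁ : ∀ z : ℝ, 0 ≤ z → z ≤ 2 →
      triWave z = 1 - 2 * z ∧ z ≤ 1 ∨ triWave z = 2 * z - 3 ∧ 1 ≤ z := fun z h₀ h₂ => by
    rw [show z = z - 1 + 1 by ring]
    have h := triWave_of_abs_le_odd (x := z - 1 + 1) 0
      (by rw [abs_le]; constructor <;> push_cast <;> linarith)
    rw [h]
    rcases abs_cases (z - 1 + 1 - (2 * ((0 : ℤ) : ℝ) + 1)) with ⟨e, h'⟩ | ⟨e, h'⟩ <;> rw [e] <;>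
      push_cast at h' ⊢
    · exact Or.inr ⟨by ring, by linarith⟩
    · exact Or.inl ⟨by ring, by linarith⟩
  have T₂ : triWave (x + y) = 1 - 2 * (x + y) ∧ x + y ≤ 1 ∨
      triWave (x + y) = 2 * (x + y) - 3 ∧ 1 ≤ x + y ∧ x + y ≤ 2 ∨
      triWave (x + y) = 5 - 2 * (x + y) ∧ 2 ≤ x + y ∧ x + y ≤ 3 ∨
      triWave (x + y) = 2 * (x + y) - 7 ∧ 3 ≤ x + y := by
    rcases le_total (x + y) 2 with h | h
    · rcases T₁ _ (by linarith) h with h' | h'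
      · exact Or.inl h'
      · exact Or.inr (Or.inl ⟨h'.1, h'.2, h⟩)
    · have h₁ := triWave_add_two_mul (x + y - 2) 1
      rw [show x + y - 2 + 2 * ((1 : ℤ) : ℝ) = x + y by push_cast; ring] at h₁
      rcases T₁ (x + y - 2) (by linarith) (by linarith) with h' | h'
      · exact Or.inr (Or.inr (Or.inl ⟨by linarith, h, by linarith⟩))
      · exact Or.inr (Or.inr (Or.inr ⟨by linarith, by linarith⟩))
  unfold OnSurface
  simp only [mul_eq_zero]
  rcases T₁ x hx₀ hx₂ with ⟨ex, hx⟩ | ⟨ex, hx⟩ <;>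
  rcases T₁ y hy₀ hy₂ with ⟨ey, hy⟩ | ⟨ey, hy⟩ <;>
  rcases T₂ with ⟨ez, hz⟩ | ⟨ez, hz, hz'⟩ | ⟨ez, hz, hz'⟩ | ⟨ez, hz⟩ <;>
  rw [ez, ex, ey] <;>
  refine ⟨by linarith, by linarith, by linarith, by linarith, ?_⟩ <;>
  first
  | exact Or.inr (by linarith)
  | exact Or.inl (Or.inr (by linarith))
  | exact Or.inl (Or.inl (Or.inr (by linarith)))
  | exact Or.inl (Or.inl (Or.inl (by linarith)))

/-- On the surface, away from the two faces meeting in the edge `Y = -ε`, the coordinate `ε * Y`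
attains its maximum `1` wherever `X = ε * Z`. -/
theorem OnSurface.eq_of_eq_mul {X Y Z ε : ℝ} (h : OnSurface X Y Z) (hε : ε ^ 2 = 1)
    (hXZ : X = ε * Z) (hG : |X + ε * Z| < 1 + ε * Y) : Y = ε := by
  have h₅ := h.2.2.2.2
  obtain ⟨hG₁, hG₂⟩ := abs_lt.1 hG
  rcases sq_eq_one_iff.1 hε with rfl | rfl
  · have e : (1 - Y) ^ 2 * ((1 + Y + 2 * Z) * (1 + Y - 2 * Z)) = 0 := by
      subst hXZ; linear_combination h₅
    have hp : 0 < (1 + Y + 2 * Z) * (1 + Y - 2 * Z) := mul_pos (by linarith) (by linarith)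
    linarith [pow_eq_zero_iff two_ne_zero |>.1 ((mul_eq_zero.1 e).resolve_right hp.ne')]
  · have e : (1 + Y) ^ 2 * ((1 - Y + 2 * Z) * (1 - Y - 2 * Z)) = 0 := by
      subst hXZ; linear_combination h₅
    have hp : 0 < (1 - Y + 2 * Z) * (1 - Y - 2 * Z) := mul_pos (by linarith) (by linarith)
    linarith [pow_eq_zero_iff two_ne_zero |>.1 ((mul_eq_zero.1 e).resolve_right hp.ne')]

theorem OnSurface.eq_mul_of_eq {X Y Z ε : ℝ} (h : OnSurface X Y Z) (hε : ε ^ 2 = 1)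
    (hY : Y = ε) : X = ε * Z := by
  obtain ⟨h₁, h₂, h₃, h₄, -⟩ := h
  rcases sq_eq_one_iff.1 hε with rfl | rfl <;> subst hY <;> linarith

/-! ### Orthogonal frames -/

/-- An origin together with three nonzero pairwise orthogonal vectors. -/
structure Frame where
  /-- The origin. -/
  o : EuclideanSpace ℝ (Fin 3)
  /-- The first vector. -/
  u : EuclideanSpace ℝ (Fin 3)
  /-- The second vector. -/
  v : EuclideanSpace ℝ (Fin 3)
  /-- The third vector. -/
  w : EuclideanSpace ℝ (Fin 3)
  u_ne : u ≠ 0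
  v_ne : v ≠ 0
  w_ne : w ≠ 0
  inner_uv : inner ℝ u v = 0
  inner_uw : inner ℝ u w = 0
  inner_vw : inner ℝ v w = 0

namespace Frame

variable (f : Frame)

/-- The frame with the first two vectors exchanged. -/
def swap₁₂ : Frame :=
  ⟨f.o, f.v, f.u, f.w, f.v_ne, f.u_ne, f.w_ne,
    by rw [real_inner_comm]; exact f.inner_uv, f.inner_vw, f.inner_uw⟩

/-- The frame with the last two vectors exchanged. -/
def swap₂₃ : Frame :=
  ⟨f.o, f.u, f.w, f.v, f.u_ne, f.w_ne, f.v_ne, f.inner_uw, f.inner_uv,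
    by rw [real_inner_comm]; exact f.inner_vw⟩

/-- The coordinate along the first vector. -/
noncomputable def cu (x : EuclideanSpace ℝ (Fin 3)) : ℝ := inner ℝ f.u (x - f.o) / ‖f.u‖ ^ 2

/-- The coordinate along the second vector. -/
noncomputable def cv (x : EuclideanSpace ℝ (Fin 3)) : ℝ := inner ℝ f.v (x - f.o) / ‖f.v‖ ^ 2

/-- The coordinate along the third vector. -/
noncomputable def cw (x : EuclideanSpace ℝ (Fin 3)) : ℝ := inner ℝ f.w (x - f.o) / ‖f.w‖ ^ 2

/-- The point with given coordinates. -/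
noncomputable def pt (X Y Z : ℝ) : EuclideanSpace ℝ (Fin 3) :=
  f.o + X • f.u + Y • f.v + Z • f.w

theorem inner_vu : inner ℝ f.v f.u = 0 := by rw [real_inner_comm]; exact f.inner_uv
theorem inner_wu : inner ℝ f.w f.u = 0 := by rw [real_inner_comm]; exact f.inner_uw
theorem inner_wv : inner ℝ f.w f.v = 0 := by rw [real_inner_comm]; exact f.inner_vw

theorem normSq_u_ne : ‖f.u‖ ^ 2 ≠ 0 := pow_ne_zero 2 (norm_ne_zero_iff.2 f.u_ne)
theorem normSq_v_ne : ‖f.v‖ ^ 2 ≠ 0 := pow_ne_zero 2 (norm_ne_zero_iff.2 f.v_ne)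
theorem normSq_w_ne : ‖f.w‖ ^ 2 ≠ 0 := pow_ne_zero 2 (norm_ne_zero_iff.2 f.w_ne)

theorem continuous_cu : Continuous f.cu := by unfold cu; fun_prop
theorem continuous_cv : Continuous f.cv := by unfold cv; fun_prop
theorem continuous_cw : Continuous f.cw := by unfold cw; fun_prop

theorem pt_sub_o (X Y Z : ℝ) : f.pt X Y Z - f.o = X • f.u + Y • f.v + Z • f.w := by
  unfold pt; abel

@[simp] theorem cu_pt (X Y Z : ℝ) : f.cu (f.pt X Y Z) = X := by
  unfold cu
  rw [pt_sub_o, div_eq_iff f.normSq_u_ne]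
  simp only [inner_add_right, inner_smul_right, f.inner_uv, f.inner_uw,
    real_inner_self_eq_norm_sq]
  ring

@[simp] theorem cv_pt (X Y Z : ℝ) : f.cv (f.pt X Y Z) = Y := by
  unfold cv
  rw [pt_sub_o, div_eq_iff f.normSq_v_ne]
  simp only [inner_add_right, inner_smul_right, f.inner_vu, f.inner_vw,
    real_inner_self_eq_norm_sq]
  ring

@[simp] theorem cw_pt (X Y Z : ℝ) : f.cw (f.pt X Y Z) = Z := by
  unfold cw
  rw [pt_sub_o, div_eq_iff f.normSq_w_ne]
  simp only [inner_add_right, inner_smul_right, f.inner_wu, f.inner_wv,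
    real_inner_self_eq_norm_sq]
  ring

theorem span_eq_top : Submodule.span ℝ (Set.range ![f.u, f.v, f.w]) = ⊤ := by
  apply LinearIndependent.span_eq_top_of_card_eq_finrank'
  · apply linearIndependent_of_ne_zero_of_inner_eq_zero (𝕜 := ℝ)
    · intro i; fin_cases i
      exacts [f.u_ne, f.v_ne, f.w_ne]
    · intro i j hij
      fin_cases i <;> fin_cases j <;>
        simp_all [f.inner_uv, f.inner_uw, f.inner_vw, f.inner_vu, f.inner_wu, f.inner_wv]
  · simp

theorem exists_eq_pt (x : EuclideanSpace ℝ (Fin 3)) : ∃ X Y Z, x = f.pt X Y Z := by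
  have hx : x - f.o ∈ Submodule.span ℝ (Set.range ![f.u, f.v, f.w]) := by
    rw [f.span_eq_top]; trivial
  obtain ⟨c, hc⟩ := (Submodule.mem_span_range_iff_exists_fun ℝ).1 hx
  refine ⟨c 0, c 1, c 2, ?_⟩
  simp only [Fin.sum_univ_three, Matrix.cons_val] at hc
  rw [← sub_left_inj (a := f.o), pt_sub_o, hc]

theorem pt_coords (x : EuclideanSpace ℝ (Fin 3)) : f.pt (f.cu x) (f.cv x) (f.cw x) = x := by
  obtain ⟨X, Y, Z, rfl⟩ := f.exists_eq_pt x
  simp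

theorem dist_sq_pt (X Y Z X' Y' Z' : ℝ) :
    dist (f.pt X Y Z) (f.pt X' Y' Z') ^ 2 =
      ‖f.u‖ ^ 2 * (X - X') ^ 2 + ‖f.v‖ ^ 2 * (Y - Y') ^ 2 + ‖f.w‖ ^ 2 * (Z - Z') ^ 2 := by
  have e : f.pt X Y Z - f.pt X' Y' Z' =
      (X - X') • f.u + (Y - Y') • f.v + (Z - Z') • f.w := by unfold pt; module
  rw [dist_eq_norm, e, ← real_inner_self_eq_norm_sq]
  simp only [inner_add_left, inner_add_right, real_inner_smul_left, real_inner_smul_right,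
    f.inner_uv, f.inner_uw, f.inner_vw, f.inner_vu, f.inner_wu, f.inner_wv,
    real_inner_self_eq_norm_sq, norm_smul, mul_pow, Real.norm_eq_abs, sq_abs]
  ring

theorem norm_mul_abs_sub_le_dist_pt (X Y Z X' Y' Z' : ℝ) :
    ‖f.u‖ * |X - X'| ≤ dist (f.pt X Y Z) (f.pt X' Y' Z') := by
  rw [← sq_le_sq₀ (by positivity) dist_nonneg, dist_sq_pt, mul_pow, sq_abs, add_assoc]
  exact le_add_of_nonneg_right (by positivity)

/-! ### The tetrahedron -/

/-- The tetrahedron inscribed in the box spanned by the frame. -/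
def tetra : Set (EuclideanSpace ℝ (Fin 3)) :=
  convexHull ℝ {f.pt 1 1 1, f.pt 1 (-1) (-1), f.pt (-1) 1 (-1), f.pt (-1) (-1) 1}

theorem cu_combo {a b : ℝ} (h : a + b = 1) (x y : EuclideanSpace ℝ (Fin 3)) :
    f.cu (a • x + b • y) = a * f.cu x + b * f.cu y := by
  have e : a • x + b • y - f.o = a • (x - f.o) + b • (y - f.o) := by
    obtain rfl : b = 1 - a := by linarith
    module
  unfold cu; rw [e, inner_add_right, real_inner_smul_right, real_inner_smul_right]; ring

theorem cv_combo {a b : ℝ} (h : a + b = 1) (x y : EuclideanSpace ℝ (Fin 3)) :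
    f.cv (a • x + b • y) = a * f.cv x + b * f.cv y := f.swap₁₂.cu_combo h x y

theorem cw_combo {a b : ℝ} (h : a + b = 1) (x y : EuclideanSpace ℝ (Fin 3)) :
    f.cw (a • x + b • y) = a * f.cw x + b * f.cw y := f.swap₂₃.cv_combo h x y

theorem mem_tetra_iff (x : EuclideanSpace ℝ (Fin 3)) :
    x ∈ f.tetra ↔ 0 ≤ 1 + f.cu x + f.cv x + f.cw x ∧ 0 ≤ 1 + f.cu x - f.cv x - f.cw x ∧
      0 ≤ 1 - f.cu x + f.cv x - f.cw x ∧ 0 ≤ 1 - f.cu x - f.cv x + f.cw x := by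
  constructor
  · suffices f.tetra ⊆ {x | 0 ≤ 1 + f.cu x + f.cv x + f.cw x ∧ 0 ≤ 1 + f.cu x - f.cv x - f.cw x ∧
      0 ≤ 1 - f.cu x + f.cv x - f.cw x ∧ 0 ≤ 1 - f.cu x - f.cv x + f.cw x} from fun h => this h
    refine convexHull_min ?_ ?_
    · rintro _ (rfl | rfl | rfl | rfl) <;> simp <;> norm_num
    · rintro x ⟨h₁, h₂, h₃, h₄⟩ y ⟨k₁, k₂, k₃, k₄⟩ a b ha hb hab
      simp only [Set.mem_ofPred_eq, f.cu_combo hab, f.cv_combo hab, f.cw_combo hab]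
      obtain rfl : b = 1 - a := by linarith
      refine ⟨?_, ?_, ?_, ?_⟩
      · linarith [mul_nonneg ha h₁, mul_nonneg hb k₁]
      · linarith [mul_nonneg ha h₂, mul_nonneg hb k₂]
      · linarith [mul_nonneg ha h₃, mul_nonneg hb k₃]
      · linarith [mul_nonneg ha h₄, mul_nonneg hb k₄]
  · rintro ⟨h₁, h₂, h₃, h₄⟩
    refine mem_convexHull_of_exists_fintype
      (![(1 + f.cu x + f.cv x + f.cw x) / 4, (1 + f.cu x - f.cv x - f.cw x) / 4,
        (1 - f.cu x + f.cv x - f.cw x) / 4, (1 - f.cu x - f.cv x + f.cw x) / 4] : Fin 4 → ℝ)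
      (![f.pt 1 1 1, f.pt 1 (-1) (-1), f.pt (-1) 1 (-1), f.pt (-1) (-1) 1]) ?_ ?_ ?_ ?_
    · intro i; fin_cases i <;> simp <;> linarith
    · simp [Fin.sum_univ_four]; ring
    · intro i; fin_cases i <;> simp
    · conv_rhs => rw [← f.pt_coords x]
      simp only [Fin.sum_univ_four, Matrix.cons_val, pt]
      module

theorem isClosed_tetra : IsClosed f.tetra :=
  ((Set.toFinite _).isCompact_convexHull (𝕜 := ℝ)).isClosed

theorem mem_frontier_tetra_iff (x : EuclideanSpace ℝ (Fin 3)) :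
    x ∈ frontier f.tetra ↔ OnSurface (f.cu x) (f.cv x) (f.cw x) := by
  have cu := f.continuous_cu
  have cv := f.continuous_cv
  have cw := f.continuous_cw
  rw [f.isClosed_tetra.frontier_eq]
  constructor
  · rintro ⟨hK, hI⟩
    obtain ⟨h₁, h₂, h₃, h₄⟩ := (f.mem_tetra_iff x).1 hK
    refine ⟨h₁, h₂, h₃, h₄, ?_⟩
    by_contra hne
    simp only [mul_eq_zero, not_or] at hne
    obtain ⟨⟨⟨n₁, n₂⟩, n₃⟩, n₄⟩ := hne
    refine hI (mem_interior.2 ⟨{x | 0 < 1 + f.cu x + f.cv x + f.cw x} ∩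
      {x | 0 < 1 + f.cu x - f.cv x - f.cw x} ∩ {x | 0 < 1 - f.cu x + f.cv x - f.cw x} ∩
      {x | 0 < 1 - f.cu x - f.cv x + f.cw x}, ?_, ?_, ?_⟩)
    · rintro y ⟨⟨⟨k₁, k₂⟩, k₃⟩, k₄⟩
      exact (f.mem_tetra_iff y).2 ⟨k₁.le, k₂.le, k₃.le, k₄.le⟩
    · refine ((IsOpen.inter ?_ ?_).inter ?_).inter ?_ <;>
        exact isOpen_lt continuous_const (by fun_prop)
    · exact ⟨⟨⟨h₁.lt_of_ne' n₁, h₂.lt_of_ne' n₂⟩, h₃.lt_of_ne' n₃⟩, h₄.lt_of_ne' n₄⟩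
  · rintro ⟨h₁, h₂, h₃, h₄, h₅⟩
    refine ⟨(f.mem_tetra_iff x).2 ⟨h₁, h₂, h₃, h₄⟩, fun hI => ?_⟩
    have hc : Continuous fun s : ℝ => f.pt (s * f.cu x) (s * f.cv x) (s * f.cw x) := by
      unfold pt; fun_prop
    have hev : ∀ᶠ s : ℝ in nhds 1,
        f.pt (s * f.cu x) (s * f.cv x) (s * f.cw x) ∈ f.tetra := by
      refine hc.continuousAt.eventually (p := (· ∈ f.tetra)) ?_
      simp only [one_mul, pt_coords]
      exact mem_interior_iff_mem_nhds.1 hI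
    obtain ⟨δ, hδ, H⟩ := Metric.eventually_nhds_iff.1 hev
    have hs := @H (1 + δ / 2) (by rw [Real.dist_eq, add_sub_cancel_left, abs_of_pos] <;> linarith)
    rw [mem_tetra_iff] at hs
    simp only [cu_pt, cv_pt, cw_pt] at hs
    obtain ⟨k₁, k₂, k₃, k₄⟩ := hs
    simp only [mul_eq_zero] at h₅
    rcases h₅ with ((h | h) | h) | h
    · nlinarith
    · nlinarith
    · nlinarith
    · nlinarith

end Frame

/-! ### Locally shortest curves -/

/-- The curve `γ` is locally shortest in `F` near the parameter `t`. -/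
def LocallyShortestAt (F : Set (EuclideanSpace ℝ (Fin 3))) (γ : ℝ → EuclideanSpace ℝ (Fin 3))
    (t : ℝ) : Prop :=
  ∃ ε > (0 : ℝ), ∀ s₁ s₂ : ℝ,
    s₁ ∈ Set.Ioo (t - ε) (t + ε) → s₂ ∈ Set.Ioo (t - ε) (t + ε) → s₁ ≤ s₂ →
    ∀ (a b : ℝ) (c : ℝ → EuclideanSpace ℝ (Fin 3)), a ≤ b →
      ContinuousOn c (Set.Icc a b) → c a = γ s₁ → c b = γ s₂ →
      (∀ x ∈ Set.Icc a b, c x ∈ F) →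
      eVariationOn γ (Set.Icc s₁ s₂) ≤ eVariationOn c (Set.Icc a b)

theorem eVariationOn_Icc_le_of_dist_le {α : Type*} [PseudoMetricSpace α] {γ : ℝ → α} {σ : ℝ}
    (hσ : 0 ≤ σ) (h : ∀ s t, dist (γ s) (γ t) ≤ σ * |s - t|) (s₁ s₂ : ℝ) :
    eVariationOn γ (Set.Icc s₁ s₂) ≤ ENNReal.ofReal (σ * (s₂ - s₁)) := by
  have hL : LipschitzWith σ.toNNReal γ :=
    LipschitzWith.of_dist_le_mul fun s t => by
      rw [Real.coe_toNNReal σ hσ, Real.dist_eq]; exact h s t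
  have hid : eVariationOn (id : ℝ → ℝ) (Set.Icc s₁ s₂) = ENNReal.ofReal (s₂ - s₁) := by simp
  have := (hL.lipschitzOnWith (s := Set.univ)).comp_eVariationOn_le (g := id)
    (s := Set.Icc s₁ s₂) (Set.mapsTo_univ _ _)
  rw [Function.comp_id, hid] at this
  exact this.trans_eq (ENNReal.ofReal_mul hσ).symm

theorem ofReal_dist_add_dist_le {α : Type*} [PseudoMetricSpace α] (c : ℝ → α) {a x b : ℝ}
    (h₁ : a ≤ x) (h₂ : x ≤ b) :
    ENNReal.ofReal (dist (c a) (c x) + dist (c x) (c b)) ≤ eVariationOn c (Set.Icc a b) := by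
  have h := eVariationOn.Icc_add_Icc c (s := Set.univ) h₁ h₂ (Set.mem_univ _)
  simp only [Set.univ_inter] at h
  rw [← h, ENNReal.ofReal_add dist_nonneg dist_nonneg, ← edist_dist, ← edist_dist]
  exact add_le_add
    (eVariationOn.edist_le c (Set.left_mem_Icc.2 h₁) (Set.right_mem_Icc.2 h₁))
    (eVariationOn.edist_le c (Set.left_mem_Icc.2 h₂) (Set.right_mem_Icc.2 h₂))

theorem ofReal_dist_le {α : Type*} [PseudoMetricSpace α] (c : ℝ → α) {a b : ℝ} (h : a ≤ b) :
    ENNReal.ofReal (dist (c a) (c b)) ≤ eVariationOn c (Set.Icc a b) := by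
  rw [← edist_dist]
  exact eVariationOn.edist_le c (Set.left_mem_Icc.2 h) (Set.right_mem_Icc.2 h)

/-- A curve of speed at most `σ` is locally shortest where chords have speed at least `σ`. -/
theorem locallyShortestAt_of_le_dist {F : Set (EuclideanSpace ℝ (Fin 3))}
    {γ : ℝ → EuclideanSpace ℝ (Fin 3)} {σ t δ : ℝ} (hσ : 0 ≤ σ)
    (hγ : ∀ s t, dist (γ s) (γ t) ≤ σ * |s - t|) (hδ : 0 < δ)
    (h : ∀ s₁ s₂, |s₁ - t| < δ → |s₂ - t| < δ → σ * |s₁ - s₂| ≤ dist (γ s₁) (γ s₂)) :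
    LocallyShortestAt F γ t := by
  refine ⟨δ, hδ, fun s₁ s₂ hs₁ hs₂ hs a b c hab _ hca hcb _ => ?_⟩
  have h' := h s₁ s₂ (by rw [abs_lt]; constructor <;> linarith [hs₁.1, hs₁.2])
    (by rw [abs_lt]; constructor <;> linarith [hs₂.1, hs₂.2])
  rw [abs_sub_comm, abs_of_nonneg (by linarith : 0 ≤ s₂ - s₁)] at h'
  refine (eVariationOn_Icc_le_of_dist_le hσ hγ _ _).trans
    ((ENNReal.ofReal_le_ofReal h').trans ?_)
  rw [← hca, ← hcb]
  exact ofReal_dist_le c hab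

namespace Frame

variable (f : Frame)

theorem dist_eq_mul_abs {X Y Z X' Y' Z' σ r : ℝ} (hσ : 0 ≤ σ)
    (h : ‖f.u‖ ^ 2 * (X - X') ^ 2 + ‖f.v‖ ^ 2 * (Y - Y') ^ 2 + ‖f.w‖ ^ 2 * (Z - Z') ^ 2 =
      σ ^ 2 * r ^ 2) :
    dist (f.pt X Y Z) (f.pt X' Y' Z') = σ * |r| := by
  rw [← sq_eq_sq₀ dist_nonneg (by positivity), dist_sq_pt, h, mul_pow, sq_abs]

/-- Crossing an edge of the tetrahedron: the two adjacent faces unfold to a plane by a reflection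
that fixes the edge. -/
theorem locallyShortestAt_of_kink {F : Set (EuclideanSpace ℝ (Fin 3))}
    (hF : ∀ x ∈ F, OnSurface (f.cu x) (f.cv x) (f.cw x))
    {γ : ℝ → EuclideanSpace ℝ (Fin 3)} (hγF : ∀ t, γ t ∈ F) {σ t δ ε X₀ Z₀ k l m : ℝ}
    (hσ : 0 ≤ σ) (hγ : ∀ s t, dist (γ s) (γ t) ≤ σ * |s - t|) (hδ : 0 < δ)
    (hε : ε ^ 2 = 1) (hZ₀ : |Z₀| < 1)
    (hloc : ∀ s, |s - t| < δ →
      γ s = f.pt (X₀ + k * (s - t)) (ε * (1 - l * |s - t|)) (Z₀ + m * (s - t)))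
    (hsp : σ ^ 2 = ‖f.u‖ ^ 2 * k ^ 2 + ‖f.v‖ ^ 2 * l ^ 2 + ‖f.w‖ ^ 2 * m ^ 2) :
    LocallyShortestAt F γ t := by
  have hcu := f.continuous_cu
  have hcv := f.continuous_cv
  have hcw := f.continuous_cw
  have hγt : γ t = f.pt X₀ ε Z₀ := by rw [hloc t (by simpa using hδ)]; simp
  have hX₀ : X₀ = ε * Z₀ := by
    have := hF _ (hγF t)
    rw [hγt] at this
    simp only [cu_pt, cv_pt, cw_pt] at this
    exact this.eq_mul_of_eq hε rfl
  have hε' : |ε| = 1 := by rw [← sq_abs] at hε; nlinarith [abs_nonneg ε]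
  have hopen : IsOpen {x | |f.cu x + ε * f.cw x| < 1 + ε * f.cv x} :=
    isOpen_lt (by fun_prop) (by fun_prop)
  obtain ⟨ρ, hρ, hball⟩ := Metric.isOpen_iff.1 hopen (γ t) (by
    change |f.cu (γ t) + ε * f.cw (γ t)| < 1 + ε * f.cv (γ t)
    rw [hγt]
    simp only [cu_pt, cv_pt, cw_pt]
    rw [hX₀, ← two_mul, ← sq, hε, abs_mul, abs_mul, hε', abs_two]; linarith)
  refine ⟨min δ (ρ / (4 * (σ + 1))), lt_min hδ (by positivity),
    fun s₁ s₂ hs₁ hs₂ hs a b c hab hc hca hcb hcF => ?_⟩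
  refine (eVariationOn_Icc_le_of_dist_le hσ hγ _ _).trans ?_
  have hs₁' : |s₁ - t| < min δ (ρ / (4 * (σ + 1))) := by
    rw [abs_lt]; constructor <;> linarith [hs₁.1, hs₁.2]
  have hs₂' : |s₂ - t| < min δ (ρ / (4 * (σ + 1))) := by
    rw [abs_lt]; constructor <;> linarith [hs₂.1, hs₂.2]
  obtain ⟨d₁, r₁⟩ := lt_min_iff.1 hs₁'
  obtain ⟨d₂, r₂⟩ := lt_min_iff.1 hs₂'
  rw [lt_div_iff₀ (by positivity)] at r₁ r₂
  by_cases hout : ∀ x ∈ Set.Icc a b, c x ∈ Metric.ball (γ t) ρ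
  · by_cases hside : s₁ ≤ t ∧ t ≤ s₂
    · have e₁ := abs_of_nonpos (sub_nonpos.2 hside.1)
      have e₂ := abs_of_nonneg (sub_nonneg.2 hside.2)
      have g₁ := hloc s₁ d₁
      have g₂ := hloc s₂ d₂
      rw [e₁] at g₁
      rw [e₂] at g₂
      have hgc : ContinuousOn (fun x => f.cu (c x) - ε * f.cw (c x)) (Set.uIcc a b) := by
        rw [Set.uIcc_of_le hab]; fun_prop
      have hzero : (0 : ℝ) ∈ Set.uIcc (f.cu (c a) - ε * f.cw (c a))
          (f.cu (c b) - ε * f.cw (c b)) := by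
        rw [hca, hcb, g₁, g₂, Set.mem_uIcc, hX₀]
        simp only [cu_pt, cw_pt]
        have E : ∀ s : ℝ, ε * Z₀ + k * s - ε * (Z₀ + m * s) = (k - ε * m) * s :=
          fun s => by ring
        rw [E, E]
        rcases le_total 0 (k - ε * m) with h | h
        · exact Or.inl ⟨mul_nonpos_of_nonneg_of_nonpos h (sub_nonpos.2 hside.1),
            mul_nonneg h (sub_nonneg.2 hside.2)⟩
        · exact Or.inr ⟨mul_nonpos_of_nonpos_of_nonneg h (sub_nonneg.2 hside.2),
            mul_nonneg_of_nonpos_of_nonpos h (sub_nonpos.2 hside.1)⟩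
      obtain ⟨x, hx, hx0⟩ := intermediate_value_uIcc hgc hzero
      rw [Set.uIcc_of_le hab] at hx
      have hvx : f.cv (c x) = ε :=
        (hF _ (hcF x hx)).eq_of_eq_mul hε (sub_eq_zero.1 hx0) (hball (hout x hx))
      have hcx := f.pt_coords (c x)
      rw [hvx] at hcx
      set p := f.pt (X₀ + k * (s₁ - t)) (ε * (1 + l * (s₁ - t))) (Z₀ + m * (s₁ - t)) with hp
      set q := f.pt (X₀ + k * (s₂ - t)) (ε * (1 + l * (s₂ - t))) (Z₀ + m * (s₂ - t)) with hq
      have hp' : γ s₁ = p := by rw [g₁, hp]; congr 2; ring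
      have hq' : dist (c x) (γ s₂) = dist (c x) q := by
        rw [← sq_eq_sq₀ dist_nonneg dist_nonneg, g₂, ← hcx, hq, dist_sq_pt, dist_sq_pt]; ring
      have hpq : dist p q = σ * |s₁ - s₂| := f.dist_eq_mul_abs hσ (by
        rw [hsp]; linear_combination ‖f.v‖ ^ 2 * l ^ 2 * (s₁ - s₂) ^ 2 * hε)
      refine le_trans (ENNReal.ofReal_le_ofReal ?_) (ofReal_dist_add_dist_le c hx.1 hx.2)
      rw [hca, hcb, hq', hp']
      refine le_trans ?_ (dist_triangle p (c x) q)
      rw [hpq, abs_sub_comm, abs_of_nonneg (sub_nonneg.2 hs)]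
    · have hd : |s₁ - t| - |s₂ - t| = s₁ - s₂ ∨ |s₁ - t| - |s₂ - t| = s₂ - s₁ := by
        rcases le_total t s₁ with h | h
        · rw [abs_of_nonneg (sub_nonneg.2 h), abs_of_nonneg (by linarith)]
          exact Or.inl (by ring)
        · have h' : s₂ ≤ t := (lt_of_not_ge fun h' => hside ⟨h, h'⟩).le
          rw [abs_of_nonpos (sub_nonpos.2 h), abs_of_nonpos (by linarith)]
          exact Or.inr (by ring)
      have hd' : (|s₁ - t| - |s₂ - t|) ^ 2 = (s₁ - s₂) ^ 2 := by
        rcases hd with h | h <;> rw [h]; ring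
      have hpq : dist (γ s₁) (γ s₂) = σ * |s₁ - s₂| := by
        rw [hloc s₁ d₁, hloc s₂ d₂]
        refine f.dist_eq_mul_abs hσ ?_
        rw [hsp]
        linear_combination ‖f.v‖ ^ 2 * l ^ 2 * (|s₁ - t| - |s₂ - t|) ^ 2 * hε +
          ‖f.v‖ ^ 2 * l ^ 2 * hd'
      rw [abs_sub_comm, abs_of_nonneg (sub_nonneg.2 hs)] at hpq
      rw [← hpq, ← hca, ← hcb]
      exact ofReal_dist_le c hab
  · push Not at hout
    obtain ⟨x, hx, hxρ⟩ := hout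
    rw [Metric.mem_ball, not_lt] at hxρ
    refine le_trans (ENNReal.ofReal_le_ofReal ?_) (ofReal_dist_add_dist_le c hx.1 hx.2)
    have h₁ := dist_triangle (c x) (c a) (γ t)
    have h₂ := hγ s₁ t
    rw [hca, dist_comm (c x) (γ s₁)] at h₁
    rw [hca]
    have h₃ : s₂ - s₁ ≤ |s₁ - t| + |s₂ - t| := by
      linarith [neg_abs_le (s₁ - t), le_abs_self (s₂ - t)]
    have h₄ := mul_le_mul_of_nonneg_left h₃ hσ
    have h₅ := dist_nonneg (x := c x) (y := c b)
    nlinarith [abs_nonneg (s₁ - t), abs_nonneg (s₂ - t)]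

end Frame

/-! ### The geodesics -/

namespace Frame

variable (f : Frame)

theorem pt_swap₁₂ (X Y Z : ℝ) : f.swap₁₂.pt Y X Z = f.pt X Y Z := by
  unfold pt swap₁₂; abel

theorem pt_swap₂₃ (X Y Z : ℝ) : f.swap₂₃.pt X Z Y = f.pt X Y Z := by
  unfold pt swap₂₃; abel

/-- The image under the folding map of the line `s ↦ (2 * s, 2 * n * s + 1 / 2)`. -/
noncomputable def geodesic (n : ℕ) (s : ℝ) : EuclideanSpace ℝ (Fin 3) :=
  f.pt (triWave (2 * n * s + 1 / 2)) (triWave (2 * s + 0)) (triWave ((2 * n + 2) * s + 1 / 2))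

/-- The speed of `geodesic`. -/
noncomputable def speed (n : ℕ) : ℝ :=
  √(‖f.u‖ ^ 2 * (2 * (2 * n)) ^ 2 + ‖f.v‖ ^ 2 * (2 * 2) ^ 2 + ‖f.w‖ ^ 2 * (2 * (2 * n + 2)) ^ 2)

theorem speed_nonneg (n : ℕ) : 0 ≤ f.speed n := Real.sqrt_nonneg _

theorem speed_sq (n : ℕ) : f.speed n ^ 2 = ‖f.u‖ ^ 2 * (2 * (2 * n)) ^ 2 +
    ‖f.v‖ ^ 2 * (2 * 2) ^ 2 + ‖f.w‖ ^ 2 * (2 * (2 * n + 2)) ^ 2 :=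
  Real.sq_sqrt (by positivity)

theorem dist_geodesic_le (n : ℕ) (s t : ℝ) :
    dist (f.geodesic n s) (f.geodesic n t) ≤ f.speed n * |s - t| := by
  have h : ∀ a b : ℝ,
      (triWave (a * s + b) - triWave (a * t + b)) ^ 2 ≤ (2 * a) ^ 2 * (s - t) ^ 2 := fun a b => by
    rw [← mul_pow, sq_le_sq]
    refine (abs_triWave_sub_le _ _).trans_eq ?_
    rw [← abs_two, ← abs_mul, abs_two]; congr 1; ring
  rw [← sq_le_sq₀ dist_nonneg (mul_nonneg (f.speed_nonneg n) (abs_nonneg _)), mul_pow, sq_abs,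
    speed_sq, geodesic, geodesic, dist_sq_pt]
  have h₁ := mul_le_mul_of_nonneg_left (h (2 * n) (1 / 2)) (sq_nonneg ‖f.u‖)
  have h₂ := mul_le_mul_of_nonneg_left (h 2 0) (sq_nonneg ‖f.v‖)
  have h₃ := mul_le_mul_of_nonneg_left (h (2 * n + 2) (1 / 2)) (sq_nonneg ‖f.w‖)
  linarith

theorem continuous_geodesic (n : ℕ) : Continuous (f.geodesic n) :=
  (LipschitzWith.of_dist_le_mul (K := (f.speed n).toNNReal) fun s t => by
    rw [Real.coe_toNNReal _ (f.speed_nonneg n), Real.dist_eq]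
    exact f.dist_geodesic_le n s t).continuous

theorem periodic_geodesic (n : ℕ) : Function.Periodic (f.geodesic n) 1 := fun s => by
  unfold geodesic
  rw [← triWave_add_two_mul (2 * n * s + 1 / 2) n, ← triWave_add_two_mul (2 * s + 0) 1,
    ← triWave_add_two_mul ((2 * n + 2) * s + 1 / 2) (n + 1)]
  push_cast
  congr 2 <;> ring

theorem geodesic_mem (n : ℕ) (s : ℝ) : f.geodesic n s ∈ frontier f.tetra := by
  rw [mem_frontier_tetra_iff, geodesic, cu_pt, cv_pt, cw_pt,
    show (2 * (n : ℝ) + 2) * s + 1 / 2 = 2 * s + 0 + (2 * n * s + 1 / 2) by ring]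
  exact onSurface_triWave _ _

theorem injOn_geodesic (n : ℕ) : Set.InjOn (f.geodesic n) (Set.Ico (0 : ℝ) 1) := by
  intro s hs t ht hst
  have h₁ := congrArg f.cu hst
  have h₂ := congrArg f.cv hst
  have h₃ := congrArg f.cw hst
  simp only [geodesic, cu_pt, cv_pt, cw_pt] at h₁ h₂ h₃
  obtain ⟨hs₀, hs₁⟩ := hs
  obtain ⟨ht₀, ht₁⟩ := ht
  obtain ⟨k, hk | hk⟩ := eq_or_eq_neg_of_triWave_eq h₂
  · have e : s - t = k := by linarith
    have k₁ : k < 1 := by exact_mod_cast (by linarith : (k : ℝ) < 1)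
    have k₂ : -1 < k := by exact_mod_cast (by linarith : (-1 : ℝ) < k)
    obtain rfl : k = 0 := by omega
    push_cast at e; linarith
  · have e : s + t = k := by linarith
    have k₁ : k < 2 := by exact_mod_cast (by linarith : (k : ℝ) < 2)
    have k₂ : -1 < k := by exact_mod_cast (by linarith : (-1 : ℝ) < k)
    obtain rfl | rfl : k = 0 ∨ k = 1 := by omega
    · push_cast at e; linarith
    · push_cast at e
      obtain rfl : t = 1 - s := by linarith
      obtain ⟨i, hi | hi⟩ := eq_or_eq_neg_of_triWave_eq h₁
      · obtain ⟨j, hj | hj⟩ := eq_or_eq_neg_of_triWave_eq h₃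
        · have e' : 2 * s = (j - i + 1 : ℤ) := by push_cast; linarith
          have l₁ : j - i + 1 < 2 := by
            exact_mod_cast (by rw [← e']; linarith : ((j - i + 1 : ℤ) : ℝ) < 2)
          have l₂ : 0 < j - i + 1 := by
            exact_mod_cast (by rw [← e']; linarith : (0 : ℝ) < ((j - i + 1 : ℤ) : ℝ))
          rw [show j - i + 1 = 1 by omega] at e'
          push_cast at e'; linarith
        · exfalso
          have : 2 * (n : ℤ) + 3 = 2 * j := by
            exact_mod_cast (by linarith : 2 * (n : ℝ) + 3 = 2 * j)
          omega
      · exfalso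
        have : 2 * (n : ℤ) + 1 = 2 * i := by
          exact_mod_cast (by linarith : 2 * (n : ℝ) + 1 = 2 * i)
        omega

theorem locallyShortestAt_geodesic (n : ℕ) (t : ℝ) :
    LocallyShortestAt (frontier f.tetra) (f.geodesic n) t := by
  have hF : ∀ x ∈ frontier f.tetra, OnSurface (f.cu x) (f.cv x) (f.cw x) :=
    fun x hx => (f.mem_frontier_tetra_iff x).1 hx
  have hx₁ : ∀ i : ℤ, 2 * t + 0 = i → ∀ j : ℤ, 2 * n * t + 1 / 2 ≠ j := fun i hi j hj => by
    have h : 2 * (n : ℝ) * i + 1 = 2 * j := by rw [← hi, ← hj]; ring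
    have h' : 2 * (n : ℤ) * i + 1 = 2 * j := by exact_mod_cast h
    have : 2 * ((n : ℤ) * i) + 1 = 2 * j := by rw [← h']; ring
    omega
  have hx₂ : ∀ i : ℤ, 2 * t + 0 = i → ∀ j : ℤ, (2 * n + 2) * t + 1 / 2 ≠ j := fun i hi j hj =>
    hx₁ i hi (j - i) (by push_cast; linarith)
  have hx₃ : ∀ i : ℤ, 2 * n * t + 1 / 2 = i → ∀ j : ℤ, (2 * n + 2) * t + 1 / 2 ≠ j :=
    fun i hi j hj => hx₁ (j - i) (by push_cast; linarith) i hi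
  by_cases hX : ∃ i : ℤ, 2 * n * t + 1 / 2 = i
  · obtain ⟨i, hi⟩ := hX
    have hY : ∀ j : ℤ, 2 * t + 0 ≠ j := fun j hj => hx₁ j hj i hi
    have hZ := hx₃ i hi
    obtain ⟨ε, hε, δ₁, hδ₁, H₁⟩ := exists_triWave_comp_eq_kink hi
    obtain ⟨m, hm, δ₂, hδ₂, H₂⟩ := exists_triWave_comp_eq_affine hY
    obtain ⟨l, hl, δ₃, hδ₃, H₃⟩ := exists_triWave_comp_eq_affine hZ
    refine f.swap₁₂.locallyShortestAt_of_kink (fun x hx => (hF x hx).swap₁₂) (f.geodesic_mem n)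
      (δ := min δ₁ (min δ₂ δ₃)) (f.speed_nonneg n) (f.dist_geodesic_le n)
      (lt_min hδ₁ (lt_min hδ₂ hδ₃)) hε (abs_triWave_lt_one hZ) (k := m)
      (l := 2 * |2 * (n : ℝ)|) (m := l) (X₀ := triWave (2 * t + 0)) (fun s hs => ?_) ?_
    · rw [lt_min_iff, lt_min_iff] at hs
      rw [geodesic, H₁ s hs.1, H₂ s hs.2.1, H₃ s hs.2.2, pt_swap₁₂]
    · rw [speed_sq, hm, hl, mul_pow 2 |_|, sq_abs]; simp only [swap₁₂]; ring
  by_cases hY : ∃ i : ℤ, 2 * t + 0 = i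
  · obtain ⟨i, hi⟩ := hY
    have hX := hx₁ i hi
    have hZ := hx₂ i hi
    obtain ⟨ε, hε, δ₁, hδ₁, H₁⟩ := exists_triWave_comp_eq_kink hi
    obtain ⟨m, hm, δ₂, hδ₂, H₂⟩ := exists_triWave_comp_eq_affine hX
    obtain ⟨l, hl, δ₃, hδ₃, H₃⟩ := exists_triWave_comp_eq_affine hZ
    refine f.locallyShortestAt_of_kink hF (f.geodesic_mem n)
      (δ := min δ₁ (min δ₂ δ₃)) (f.speed_nonneg n) (f.dist_geodesic_le n)
      (lt_min hδ₁ (lt_min hδ₂ hδ₃)) hε (abs_triWave_lt_one hZ) (k := m)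
      (l := 2 * |(2 : ℝ)|) (m := l) (X₀ := triWave (2 * n * t + 1 / 2)) (fun s hs => ?_) ?_
    · rw [lt_min_iff, lt_min_iff] at hs
      rw [geodesic, H₁ s hs.1, H₂ s hs.2.1, H₃ s hs.2.2]
    · rw [speed_sq, hm, hl, abs_two]
  by_cases hZ : ∃ i : ℤ, (2 * n + 2) * t + 1 / 2 = i
  · obtain ⟨i, hi⟩ := hZ
    push Not at hX hY
    obtain ⟨ε, hε, δ₁, hδ₁, H₁⟩ := exists_triWave_comp_eq_kink hi
    obtain ⟨m, hm, δ₂, hδ₂, H₂⟩ := exists_triWave_comp_eq_affine hX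
    obtain ⟨l, hl, δ₃, hδ₃, H₃⟩ := exists_triWave_comp_eq_affine hY
    refine f.swap₂₃.locallyShortestAt_of_kink (fun x hx => (hF x hx).swap₂₃) (f.geodesic_mem n)
      (δ := min δ₁ (min δ₂ δ₃)) (f.speed_nonneg n) (f.dist_geodesic_le n)
      (lt_min hδ₁ (lt_min hδ₂ hδ₃)) hε (abs_triWave_lt_one hY) (k := m)
      (l := 2 * |2 * (n : ℝ) + 2|) (m := l) (X₀ := triWave (2 * n * t + 1 / 2))
      (fun s hs => ?_) ?_
    · rw [lt_min_iff, lt_min_iff] at hs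
      rw [geodesic, H₁ s hs.1, H₂ s hs.2.1, H₃ s hs.2.2, pt_swap₂₃]
    · rw [speed_sq, hm, hl, mul_pow 2 |_|, sq_abs]; simp only [swap₂₃]; ring
  push Not at hX hY hZ
  obtain ⟨k, hk, δ₁, hδ₁, H₁⟩ := exists_triWave_comp_eq_affine hX
  obtain ⟨l, hl, δ₂, hδ₂, H₂⟩ := exists_triWave_comp_eq_affine hY
  obtain ⟨m, hm, δ₃, hδ₃, H₃⟩ := exists_triWave_comp_eq_affine hZ
  refine locallyShortestAt_of_le_dist (f.speed_nonneg n) (f.dist_geodesic_le n)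
    (lt_min hδ₁ (lt_min hδ₂ hδ₃)) fun s₁ s₂ d₁ d₂ => ?_
  rw [lt_min_iff, lt_min_iff] at d₁ d₂
  rw [geodesic, geodesic, H₁ s₁ d₁.1, H₂ s₁ d₁.2.1, H₃ s₁ d₁.2.2, H₁ s₂ d₂.1, H₂ s₂ d₂.2.1,
    H₃ s₂ d₂.2.2]
  refine (f.dist_eq_mul_abs (f.speed_nonneg n) ?_).ge
  rw [speed_sq, ← hk, ← hl, ← hm]; ring

theorem le_eVariationOn_geodesic (n : ℕ) :
    (2 * n + 1 : ℕ) • ENNReal.ofReal (2 * ‖f.u‖) ≤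
      eVariationOn (f.geodesic (n + 1)) (Set.Icc 0 1) := by
  have hn : (0 : ℝ) < 2 * ((n + 1 : ℕ) : ℝ) := by positivity
  have hmono : MonotoneOn (fun i : ℕ => ((i : ℝ) + 1 / 2) / (2 * ((n + 1 : ℕ) : ℝ)))
      (Set.Icc 0 (2 * n + 1)) := fun i _ j _ hij => by
    have : (i : ℝ) ≤ j := by exact_mod_cast hij
    dsimp only
    gcongr
  refine le_trans ?_ (eVariationOn.sum_le_of_monotoneOn_Icc hmono fun i hi => ?_)
  · refine le_of_eq_of_le (by rw [Nat.card_Ico, Nat.sub_zero])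
      (Finset.card_nsmul_le_sum _ _ (ENNReal.ofReal (2 * ‖f.u‖)) fun i _ => ?_)
    rw [edist_dist]
    refine ENNReal.ofReal_le_ofReal ?_
    have e : ∀ x : ℝ, 2 * ((n + 1 : ℕ) : ℝ) * ((x + 1 / 2) / (2 * ((n + 1 : ℕ) : ℝ))) + 1 / 2 =
        x + 1 := fun x => by rw [mul_div_cancel₀ _ hn.ne']; ring
    refine le_trans ?_ (f.norm_mul_abs_sub_le_dist_pt _ _ _ _ _ _)
    rw [e, e]
    obtain ⟨ε, hε, H⟩ := exists_triWave_eq_kink (i + 1)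
    have h₁ := H (i + 1) (by push_cast; simp)
    have h₂ := H ((i + 1 : ℕ) + 1) (by push_cast; simp)
    push_cast at h₁ h₂ ⊢
    have h₃ : |ε * (1 - 2 * |(i : ℝ) + 1 + 1 - (i + 1)|) -
        ε * (1 - 2 * |(i : ℝ) + 1 - (i + 1)|)| = 2 := by
      rw [add_sub_cancel_left, sub_self, abs_one, abs_zero]
      rcases sq_eq_one_iff.1 hε with rfl | rfl <;> norm_num
    rw [h₁, h₂, h₃, mul_comm]
  · have h : (i : ℝ) ≤ 2 * n + 1 := by exact_mod_cast hi.2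
    refine ⟨by positivity, ?_⟩
    rw [div_le_one hn]; push_cast; linarith

theorem exists_lt_eVariationOn_geodesic (L : ℝ) :
    ∃ n, ENNReal.ofReal L < eVariationOn (f.geodesic n) (Set.Icc 0 1) := by
  have hu : 0 < 2 * ‖f.u‖ := by have := norm_pos_iff.2 f.u_ne; positivity
  obtain ⟨n, hn⟩ := exists_nat_gt (L / (2 * ‖f.u‖))
  rw [div_lt_iff₀ hu] at hn
  refine ⟨n + 1, lt_of_lt_of_le ?_ (f.le_eVariationOn_geodesic n)⟩
  rw [← ENNReal.ofReal_nsmul, nsmul_eq_mul]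
  refine (ENNReal.ofReal_lt_ofReal_iff (by positivity)).2 (hn.trans_le ?_)
  push_cast
  gcongr
  linarith [(n.cast_nonneg : (0 : ℝ) ≤ n)]

theorem isSimpleClosedGeodesicIn_geodesic {n : ℕ}
    (h : 0 < eVariationOn (f.geodesic n) (Set.Icc 0 1)) :
    IsSimpleClosedGeodesicIn (frontier f.tetra) (f.geodesic n) :=
  ⟨f.continuous_geodesic n, f.periodic_geodesic n, f.injOn_geodesic n, f.geodesic_mem n, h,
    (eVariationOn_Icc_le_of_dist_le (f.speed_nonneg n) (f.dist_geodesic_le n)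
      _ _).trans_lt ENNReal.ofReal_lt_top, f.locallyShortestAt_geodesic n⟩

end Frame

theorem inner_eq_zero_of_norm_add_eq_norm_sub {x y : EuclideanSpace ℝ (Fin 3)}
    (h : ‖x + y‖ = ‖x - y‖) : inner ℝ x y = 0 := by
  have h₁ := norm_add_sq_real x y
  have h₂ := norm_sub_sq_real x y
  rw [h] at h₁; linarith

/-- A disphenoid is inscribed in a box. -/
theorem exists_frame {A B C D : EuclideanSpace ℝ (Fin 3)}
    (hindep : AffineIndependent ℝ ![A, B, C, D])
    (h₁ : dist A B = dist C D) (h₂ : dist A C = dist B D) (h₃ : dist A D = dist B C) :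
    ∃ f : Frame, f.tetra = convexHull ℝ {A, B, C, D} := by
  have key : ∀ a b c d : ℝ, a + b + c + d = 0 → a • A + b • B + c • C + d • D = 0 → a = 0 := by
    intro a b c d h h'
    exact affineIndependent_iff.1 hindep Finset.univ ![a, b, c, d]
      (by simpa [Fin.sum_univ_four] using h) (by simpa [Fin.sum_univ_four] using h') 0
      (Finset.mem_univ _)
  have half : ∀ P Q R S x y : EuclideanSpace ℝ (Fin 3), dist P Q = dist R S →
      x + y = (1 / 2 : ℝ) • (P - Q) → x - y = (1 / 2 : ℝ) • (R - S) → inner ℝ x y = 0 := by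
    intro P Q R S x y h e e'
    refine inner_eq_zero_of_norm_add_eq_norm_sub ?_
    rw [e, e', norm_smul, norm_smul, ← dist_eq_norm, ← dist_eq_norm, h]
  refine ⟨⟨(1 / 4 : ℝ) • (A + B + C + D), (1 / 4 : ℝ) • (A + B - C - D),
    (1 / 4 : ℝ) • (A + C - B - D), (1 / 4 : ℝ) • (A + D - B - C), fun h => ?_, fun h => ?_,
    fun h => ?_, half A D B C _ _ h₃ (by module) (by module),
    half A C B D _ _ h₂ (by module) (by module),
    half A B C D _ _ h₁ (by module) (by module)⟩, ?_⟩
  · have := key (1 / 4) (1 / 4) (-(1 / 4)) (-(1 / 4)) (by norm_num) (by rw [← h]; module)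
    norm_num at this
  · have := key (1 / 4) (-(1 / 4)) (1 / 4) (-(1 / 4)) (by norm_num) (by rw [← h]; module)
    norm_num at this
  · have := key (1 / 4) (-(1 / 4)) (-(1 / 4)) (1 / 4) (by norm_num) (by rw [← h]; module)
    norm_num at this
  · unfold Frame.tetra Frame.pt
    congr 2
    · module
    congr 1
    · module
    congr 1
    · module
    congr 1
    module

end Disphenoid

/-- An isosceles tetrahedron (disphenoid) admits arbitrarily long simple closed
geodesics on its surface. -/
theorem disphenoid_has_long_geodesics
    (A B C D : EuclideanSpace ℝ (Fin 3))
    (hindep : AffineIndependent ℝ ![A, B, C, D])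
    (h₁ : dist A B = dist C D) (h₂ : dist A C = dist B D)
    (h₃ : dist A D = dist B C) :
    ∀ L : ℝ, ∃ γ : ℝ → EuclideanSpace ℝ (Fin 3),
      IsSimpleClosedGeodesicIn (frontier (convexHull ℝ {A, B, C, D})) γ ∧
      ENNReal.ofReal L < eVariationOn γ (Set.Icc 0 1) := by
  intro L
  obtain ⟨f, hf⟩ := Disphenoid.exists_frame hindep h₁ h₂ h₃
  obtain ⟨n, hn⟩ := f.exists_lt_eVariationOn_geodesic L
  rw [← hf]
  exact ⟨f.geodesic n, f.isSimpleClosedGeodesicIn_geodesic (pos_of_gt hn), hn⟩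
end

section
/- Let A, B, C, D ∈ E = EuclideanSpace ℝ (Fin 3) be affinely independent. Then the tetrahedron ABCD is isosceles (dist A B = dist C D, dist A C = dist B D, dist A D = dist B C) if and only if the sum of the three face angles at each of its four vertices equals π, i.e., ∠ B A C + ∠ C A D + ∠ D A B = π, ∠ A B C + ∠ C B D + ∠ D B A = π, ∠ A C B + ∠ B C D + ∠ D C A = π, and ∠ A D B + ∠ B D C + ∠ C D A = π (where ∠ X Y Z denotes the Euclidean angle at Y in the triangle XYZ). -/
open EuclideanGeometry

/-- If the face angles of a tetrahedron add up to `π` at both `A` and `D`, then the squared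
distances from `A` and from `D` to the other two vertices have the same sum. -/
theorem sq_dist_add_sq_dist_eq_of_angle_sums_eq_pi
    {V P : Type*} [NormedAddCommGroup V] [InnerProductSpace ℝ V] [MetricSpace P]
    [NormedAddTorsor V P] {A B C D : P} (hAD : A ≠ D)
    (hA : ∠ B A C + ∠ C A D + ∠ D A B = Real.pi)
    (hD : ∠ A D B + ∠ B D C + ∠ C D A = Real.pi) :
    dist A B ^ 2 + dist A C ^ 2 = dist B D ^ 2 + dist C D ^ 2 := by
  have cosA : Real.cos (∠ B A C) = Real.sin (∠ C A D) * Real.sin (∠ D A B)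
      - Real.cos (∠ C A D) * Real.cos (∠ D A B) := by
    rw [show ∠ B A C = Real.pi - (∠ C A D + ∠ D A B) by linarith, Real.cos_pi_sub,
      Real.cos_add]
    ring
  have cosD : Real.cos (∠ B D C) = Real.sin (∠ C D A) * Real.sin (∠ A D B)
      - Real.cos (∠ C D A) * Real.cos (∠ A D B) := by
    rw [show ∠ B D C = Real.pi - (∠ C D A + ∠ A D B) by linarith, Real.cos_pi_sub,
      Real.cos_add]
    ring
  have hp : dist A D ≠ 0 := dist_ne_zero.mpr hAD
  have s₁ := law_sin D A B
  have s₂ := law_sin D A C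
  have c₁ := law_cos B A C
  have c₂ := law_cos C A D
  have c₃ := law_cos D A B
  have c₄ := law_cos B D C
  have c₅ := law_cos C D A
  have c₆ := law_cos A D B
  rw [angle_comm B D A] at s₁
  rw [angle_comm D A C] at s₂
  simp only [dist_comm B A, dist_comm C A, dist_comm D A, dist_comm D B]
    at s₁ s₂ c₁ c₂ c₃ c₄ c₅ c₆
  have sines := congrArg₂ (· * ·) s₁ s₂
  have cosinesA : 4 * dist A D ^ 2 * (dist A B * dist A C *
      (Real.cos (∠ C A D) * Real.cos (∠ D A B))) =
      (dist A D ^ 2 + dist A B ^ 2 - dist B D ^ 2) *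
        (dist A D ^ 2 + dist A C ^ 2 - dist C D ^ 2) := by
    rw [show dist A D ^ 2 + dist A B ^ 2 - dist B D ^ 2 =
        2 * dist A D * dist A B * Real.cos (∠ D A B) by linear_combination -c₃,
      show dist A D ^ 2 + dist A C ^ 2 - dist C D ^ 2 =
        2 * dist A C * dist A D * Real.cos (∠ C A D) by linear_combination -c₂]
    ring
  have cosinesD : 4 * dist A D ^ 2 * (dist B D * dist C D *
      (Real.cos (∠ C D A) * Real.cos (∠ A D B))) =
      (dist A D ^ 2 + dist B D ^ 2 - dist A B ^ 2) *
        (dist A D ^ 2 + dist C D ^ 2 - dist A C ^ 2) := by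
    rw [show dist A D ^ 2 + dist B D ^ 2 - dist A B ^ 2 =
        2 * dist A D * dist B D * Real.cos (∠ A D B) by linear_combination -c₆,
      show dist A D ^ 2 + dist C D ^ 2 - dist A C ^ 2 =
        2 * dist C D * dist A D * Real.cos (∠ C D A) by linear_combination -c₅]
    ring
  rw [cosA] at c₁
  rw [cosD] at c₄
  refine mul_left_cancel₀ (pow_ne_zero 2 hp) ?_
  linear_combination (1 / 2) * dist A D ^ 2 * (c₄ - c₁) + dist A D ^ 2 * sines
    + (cosinesD - cosinesA) / 4

/-- In a tetrahedron `ABCD` with opposite edges equal, the face angles at `A` add up to `π`. -/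
theorem angle_sum_eq_pi_of_opposite_dist_eq
    {V P : Type*} [NormedAddCommGroup V] [InnerProductSpace ℝ V] [MetricSpace P]
    [NormedAddTorsor V P] {A B C D : P} (hAB : A ≠ B) (h₁ : dist A B = dist C D)
    (h₂ : dist A C = dist B D) (h₃ : dist A D = dist B C) :
    ∠ B A C + ∠ C A D + ∠ D A B = Real.pi := by
  have cCAD : Congruent ![C, A, D] ![A, C, B] :=
    side_side_side (dist_comm C A) (h₃.trans (dist_comm B C))
      (by rw [dist_comm D C, dist_comm B A, h₁])
  have cDAB : Congruent ![D, A, B] ![C, B, A] :=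
    side_side_side (by rw [dist_comm D A, dist_comm C B, h₃]) (dist_comm A B) h₂.symm
  have hCAD : ∠ C A D = ∠ A C B := angle_eq_of_congruent cCAD 0 1 2
  have hDAB : ∠ D A B = ∠ C B A := angle_eq_of_congruent cDAB 0 1 2
  rw [hCAD, hDAB, angle_comm B A C, angle_comm A C B, angle_comm C B A]
  linarith [angle_add_angle_add_angle_eq_pi C hAB.symm]

/-- A tetrahedron is isosceles (a disphenoid) if and only if the sum of the
three face angles at each of its four vertices equals `π`. -/
theorem isosceles_iff_angle_sums_pi
    (A B C D : EuclideanSpace ℝ (Fin 3))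
    (hindep : AffineIndependent ℝ ![A, B, C, D]) :
    (dist A B = dist C D ∧ dist A C = dist B D ∧ dist A D = dist B C) ↔
      (∠ B A C + ∠ C A D + ∠ D A B = Real.pi ∧
       ∠ A B C + ∠ C B D + ∠ D B A = Real.pi ∧
       ∠ A C B + ∠ B C D + ∠ D C A = Real.pi ∧
       ∠ A D B + ∠ B D C + ∠ C D A = Real.pi) := by
  have hne : ∀ i j : Fin 4, i ≠ j → ![A, B, C, D] i ≠ ![A, B, C, D] j :=
    fun i j hij => hindep.injective.ne hij
  have hAB : A ≠ B := hne 0 1 (by decide)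
  have hAD : A ≠ D := hne 0 3 (by decide)
  have hBD : B ≠ D := hne 1 3 (by decide)
  have hCD : C ≠ D := hne 2 3 (by decide)
  constructor
  · rintro ⟨h₁, h₂, h₃⟩
    have hA := angle_sum_eq_pi_of_opposite_dist_eq hAB h₁ h₂ h₃
    have hB := angle_sum_eq_pi_of_opposite_dist_eq (A := B) (B := A) (C := C) (D := D) hAB.symm
      (by rw [dist_comm B A, h₁]) h₃.symm h₂.symm
    have hC := angle_sum_eq_pi_of_opposite_dist_eq (A := C) (B := A) (C := B) (D := D)
      (hne 2 0 (by decide)) (by rw [dist_comm C A, h₂]) (by rw [dist_comm C B, h₃]) h₁.symm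
    have hD := angle_sum_eq_pi_of_opposite_dist_eq (A := D) (B := A) (C := B) (D := C)
      hAD.symm (by rw [dist_comm D A, h₃]) (by rw [dist_comm D B, h₂])
      (by rw [dist_comm D C, h₁])
    exact ⟨hA, hB, hC, hD⟩
  · rintro ⟨hA, hB, hC, hD⟩
    have eA := sq_dist_add_sq_dist_eq_of_angle_sums_eq_pi hAD hA hD
    have eB := sq_dist_add_sq_dist_eq_of_angle_sums_eq_pi (A := B) (B := A) (C := C) hBD hB
      (by rw [angle_comm B D A, angle_comm A D C, angle_comm C D B]; linarith)
    have eC := sq_dist_add_sq_dist_eq_of_angle_sums_eq_pi (A := C) (B := A) (C := B) hCD hC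
      (by linarith)
    rw [dist_comm B A] at eB
    rw [dist_comm C A, dist_comm C B] at eC
    refine ⟨?_, ?_, ?_⟩ <;> rw [← sq_eq_sq₀ dist_nonneg dist_nonneg] <;> linarith
end
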